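/- arXiv:2407.03870 — 3 statements merged into one kernel-verified Lean document; each statement's English description precedes it below -/
import Mathlib

section
/- Let J : ℝ^d → [0,∞) be integrable, ε > 0 and t ≥ 0. Then for every f ∈ L¹(ℝ^d), J_ε * (T_t f) = T_t (J_{ε e^t} * f) almost everywhere on ℝ^d; explicitly, (J_ε * T_t f)(x) = e^{(d − 1/ε²)t} (J_{ε e^t} * f)(e^t x) for almost every x. -/
open MeasureTheory Real Filter

noncomputable section

abbrev Ed (d : ℕ) := EuclideanSpace ℝ (Fin d)

/-- Convolution of two functions on `ℝ^d`. -/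
def conv {d : ℕ} (J u : Ed d → ℝ) : Ed d → ℝ := fun x => ∫ y, J (x - y) * u y

/-- The scaled kernel `J_c(x) = c^{-d} J(x/c)`. -/
def scaleK {d : ℕ} (J : Ed d → ℝ) (c : ℝ) : Ed d → ℝ := fun x => (c ^ d)⁻¹ * J (c⁻¹ • x)

/-- The semigroup `(T_t u)(x) = e^{(d-1/ε²)t} u(e^t x)`. -/
def Tt {d : ℕ} (ε t : ℝ) (u : Ed d → ℝ) : Ed d → ℝ :=
  fun x => Real.exp (((d : ℝ) - 1 / ε ^ 2) * t) * u (Real.exp t • x)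

/-- Mild solution of the nonlocal Fokker–Planck equation
`∂_t u = (1/ε²)(J_ε * u - u) + div(x u)` on `[0,∞)` with initial datum `u₀`, in the
weighted Lebesgue space with weight `V`: a curve `u ∈ C([0,∞), L¹_V)` satisfying
Duhamel's formula `u(t) = T_t u₀ + (1/ε²) ∫₀ᵗ T_{t-s}[J_ε * u(s)] ds`. -/
def IsMildSolution {d : ℕ} (ε : ℝ) (J : Ed d → ℝ) (V : Ed d → ℝ)
    (u₀ : Ed d → ℝ) (u : ℝ → Ed d → ℝ) : Prop :=
  (∀ t, AEStronglyMeasurable (u t) volume) ∧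
  (∀ t ≥ 0, Integrable (fun x => V x * |u t x|)) ∧
  (∀ t₀ ≥ 0, Tendsto (fun t => ∫ x, V x * |u t x - u t₀ x|) (nhdsWithin t₀ (Set.Ici 0)) (nhds 0)) ∧
  (∀ t ≥ 0, ∀ᵐ x, u t x = Tt ε t u₀ x
      + (1 / ε ^ 2) * ∫ s in Set.Ioc (0:ℝ) t, Tt ε (t - s) (conv (scaleK J ε) (u s)) x)
theorem conv_scaleK_comp_smul {d : ℕ} (J f : Ed d → ℝ) {ε r : ℝ} (hr : 0 < r) (x : Ed d) :
    conv (scaleK J ε) (fun y => f (r • y)) x = conv (scaleK J (ε * r)) f (r • x) := by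
  have h := Measure.integral_comp_smul (volume : Measure (Ed d))
    (fun z => (ε ^ d)⁻¹ * J ((ε * r)⁻¹ • (r • x - z)) * f z) r
  rw [finrank_euclideanSpace_fin, abs_of_pos (by positivity), smul_eq_mul,
    ← integral_const_mul] at h
  simp only [conv, scaleK]
  refine Eq.trans (integral_congr_ae (.of_forall fun y => ?_))
    (h.trans (integral_congr_ae (.of_forall fun z => ?_)))
  · have hs : (ε * r)⁻¹ • (r • x - r • y) = ε⁻¹ • (x - y) := by
      rw [← smul_sub, smul_smul, mul_inv, inv_mul_cancel_right₀ hr.ne']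
    simp only [hs]
  · simp only [mul_pow, mul_inv]
    ring

theorem conv_const_mul {d : ℕ} (J u : Ed d → ℝ) (c : ℝ) (x : Ed d) :
    conv J (fun y => c * u y) x = c * conv J u x := by
  simp only [conv, mul_left_comm _ c, integral_const_mul]

/-- Lemma 2.6: `J_ε * (T_t f) = T_t (J_{ε e^t} * f)` almost everywhere; explicitly,
`(J_ε * T_t f)(x) = e^{(d - 1/ε²)t} (J_{ε e^t} * f)(e^t x)` for a.e. `x`. -/
theorem conv_Tt_commute (d : ℕ) (ε t : ℝ) (hε : 0 < ε) (ht : 0 ≤ t)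
    (J : Ed d → ℝ) (hJnn : ∀ x, 0 ≤ J x) (hJ : Integrable J)
    (f : Ed d → ℝ) (hf : Integrable f) :
    ∀ᵐ x, conv (scaleK J ε) (Tt ε t f) x
      = Real.exp (((d : ℝ) - 1 / ε ^ 2) * t) *
          conv (scaleK J (ε * Real.exp t)) f (Real.exp t • x) := by
  refine .of_forall fun x => ?_
  rw [← conv_scaleK_comp_smul J f (Real.exp_pos t), ← conv_const_mul]
  rfl
end
end

section
/- Let J : ℝ^d → [0,∞) satisfy ∫ J = 1, ∫ J(x) x dx = 0, ∫ J(x) x_i x_j dx = 2δ_{ij}, and J ∈ L¹_{k'} for some k' ≥ 2. Then for every 0 < k ≤ k' there exist constants C, λ > 0 depending only on k, d and J (in particular independent of ε) such that for every ε ∈ (0,1] and every x ∈ ℝ^d: (1/ε²) ∫_{ℝ^d} J(z) (⟨x − εz⟩^k − ⟨x⟩^k) dz − k|x|²⟨x⟩^{k−2} ≤ C − λ⟨x⟩^k. (The left-hand side equals L_ε^*(⟨·⟩^k)(x), where L_ε^*φ = (1/ε²)(J_ε * φ − φ) − x·∇φ with the reflected convolution written out explicitly.) -/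
open MeasureTheory Real Filter

noncomputable section

/-- ⟨x⟩ = (1+|x|²)^{1/2} -/
def jap {d : ℕ} (x : Ed d) : ℝ := Real.sqrt (1 + ‖x‖ ^ 2)

lemma one_le_jap {d : ℕ} (x : Ed d) : 1 ≤ jap x := by
  rw [jap, Real.one_le_sqrt]
  nlinarith [sq_nonneg ‖x‖]

lemma jap_sq {d : ℕ} (x : Ed d) : jap x ^ 2 = 1 + ‖x‖ ^ 2 :=
  Real.sq_sqrt (by positivity)

lemma abs_jap_sub_le {d : ℕ} (x y : Ed d) : |jap x - jap y| ≤ ‖x - y‖ := by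
  have hx := one_le_jap x
  have hy := one_le_jap y
  have hxn : ‖x‖ ≤ jap x := Real.le_sqrt_of_sq_le (by linarith)
  have hyn : ‖y‖ ≤ jap y := Real.le_sqrt_of_sq_le (by linarith)
  have h1 : (jap x - jap y) * (jap x + jap y) = (‖x‖ - ‖y‖) * (‖x‖ + ‖y‖) := by
    linear_combination jap_sq x - jap_sq y
  have h2 : |jap x - jap y| * (jap x + jap y) = |‖x‖ - ‖y‖| * (‖x‖ + ‖y‖) := by
    have := congrArg abs h1
    rwa [abs_mul, abs_mul, abs_of_pos (by linarith : 0 < jap x + jap y),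
      abs_of_nonneg (by positivity : 0 ≤ ‖x‖ + ‖y‖)] at this
  refine le_trans ?_ (abs_norm_sub_norm_le x y)
  refine le_of_mul_le_mul_right ?_ (by linarith : 0 < jap x + jap y)
  rw [h2]
  gcongr

/-- The tangent-line inequality for `t ↦ t ^ (k / 2)`, concave case, written in `t = a ^ 2`. -/
lemma rpow_sub_le_of_le_two {a b k : ℝ} (ha : 0 < a) (hb : 0 < b) (hk : 0 < k) (hk2 : k ≤ 2) :
    b ^ k - a ^ k ≤ k / 2 * a ^ (k - 2) * (b ^ 2 - a ^ 2) := by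
  have h := rpow_one_add_le_one_add_mul_self (s := (b / a) ^ 2 - 1) (p := k / 2)
    (by linarith [sq_nonneg (b / a)]) (by linarith) (by linarith)
  have e : (1 + ((b / a) ^ 2 - 1)) ^ (k / 2) = b ^ k / a ^ k := by
    rw [add_sub_cancel, ← Real.rpow_natCast, ← Real.rpow_mul (by positivity),
      ← Real.div_rpow hb.le ha.le]
    congr 1
    push_cast
    ring
  rw [e, div_le_iff₀ (by positivity)] at h
  have e2 : a ^ k = a ^ (k - 2) * a ^ 2 := by
    rw [← Real.rpow_natCast, ← Real.rpow_add ha]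
    simp
  have e3 : (1 + k / 2 * ((b / a) ^ 2 - 1)) * a ^ k
      = a ^ k + k / 2 * a ^ (k - 2) * (b ^ 2 - a ^ 2) := by
    rw [e2]
    field_simp
  linarith

/-- The tangent-line inequality for `t ↦ t ^ (k / 2)`, convex case, written in `t = a ^ 2`. -/
lemma rpow_sub_le_of_two_le {a b k : ℝ} (ha : 0 < a) (hb : 0 < b) (hk2 : 2 ≤ k) :
    b ^ k - a ^ k ≤ k / 2 * b ^ (k - 2) * (b ^ 2 - a ^ 2) := by
  have h := one_add_mul_self_le_rpow_one_add (s := (a / b) ^ 2 - 1)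
    (by linarith [sq_nonneg (a / b)]) (p := k / 2) (by linarith)
  have e : (1 + ((a / b) ^ 2 - 1)) ^ (k / 2) = a ^ k / b ^ k := by
    rw [add_sub_cancel, ← Real.rpow_natCast, ← Real.rpow_mul (by positivity),
      ← Real.div_rpow ha.le hb.le]
    congr 1
    push_cast
    ring
  rw [e, le_div_iff₀ (by positivity)] at h
  have e2 : b ^ k = b ^ (k - 2) * b ^ 2 := by
    rw [← Real.rpow_natCast, ← Real.rpow_add hb]
    simp
  have e3 : (1 + k / 2 * ((a / b) ^ 2 - 1)) * b ^ k
      = b ^ k - k / 2 * b ^ (k - 2) * (b ^ 2 - a ^ 2) := by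
    rw [e2]
    field_simp
    ring
  linarith

lemma rpow_sub_mul_add_le {a b r : ℝ} (hb : 0 < b) (hba : b ≤ a) (hr : 0 ≤ r) :
    (a ^ r - b ^ r) * (a + b) ≤ 2 * (1 + r) * a ^ r * (a - b) := by
  have ha : 0 < a := hb.trans_le hba
  have hs : b / a ≤ 1 := (div_le_one ha).2 hba
  have hs0 : 0 < b / a := by positivity
  have key : 1 - (b / a) ^ r ≤ (1 + r) * (1 - b / a) := by
    rcases le_total r 1 with h | h
    · have := Real.rpow_le_rpow_of_exponent_ge hs0 hs h
      rw [Real.rpow_one] at this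
      nlinarith
    · have := one_add_mul_self_le_rpow_one_add (s := b / a - 1) (by linarith) h
      rw [add_sub_cancel] at this
      nlinarith
  rw [Real.div_rpow hb.le ha.le] at key
  have har : 0 < a ^ r := by positivity
  have h1 : (a ^ r - b ^ r) * a ≤ (1 + r) * a ^ r * (a - b) := by
    have := mul_le_mul_of_nonneg_right key (by positivity : 0 ≤ a ^ r * a)
    field_simp at this
    nlinarith
  have h2 : 0 ≤ a ^ r - b ^ r := sub_nonneg.2 (by gcongr)
  nlinarith

lemma rpow_sub_mul_sq_sub_le {a b r : ℝ} (ha : 0 < a) (hb : 0 < b) (hr : 0 ≤ r) :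
    (b ^ r - a ^ r) * (b ^ 2 - a ^ 2) ≤ 2 * (1 + r) * (a ^ r + b ^ r) * (b - a) ^ 2 := by
  have har : 0 < a ^ r := by positivity
  have hbr : 0 < b ^ r := by positivity
  rcases le_total a b with h | h
  · have := mul_le_mul_of_nonneg_right (rpow_sub_mul_add_le ha h hr) (sub_nonneg.2 h)
    have : 0 ≤ 2 * (1 + r) * a ^ r * (b - a) ^ 2 := by positivity
    linarith
  · have := mul_le_mul_of_nonneg_right (rpow_sub_mul_add_le hb h hr) (sub_nonneg.2 h)
    have : 0 ≤ 2 * (1 + r) * b ^ r * (b - a) ^ 2 := by positivity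
    linarith

lemma add_rpow_le_two_rpow_mul {a c r : ℝ} (ha : 0 ≤ a) (hc : 0 ≤ c) (hr : 0 ≤ r) :
    (a + c) ^ r ≤ 2 ^ r * (a ^ r + c ^ r) := by
  have har : 0 ≤ a ^ r := by positivity
  have hcr : 0 ≤ c ^ r := by positivity
  have h2 : (0 : ℝ) ≤ 2 ^ r := by positivity
  rcases le_total a c with h | h
  · calc (a + c) ^ r ≤ (2 * c) ^ r := by gcongr; linarith
      _ = 2 ^ r * c ^ r := Real.mul_rpow (by norm_num) hc
      _ ≤ _ := by gcongr; linarith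
  · calc (a + c) ^ r ≤ (2 * a) ^ r := by gcongr; linarith
      _ = 2 ^ r * a ^ r := Real.mul_rpow (by norm_num) ha
      _ ≤ _ := by gcongr; linarith

lemma jap_sub_smul_sq {d : ℕ} (x z : Ed d) (ε : ℝ) :
    jap (x - ε • z) ^ 2 - jap x ^ 2 = -2 * ε * inner ℝ x z + ε ^ 2 * ‖z‖ ^ 2 := by
  rw [jap_sq, jap_sq, norm_sub_sq_real, inner_smul_right, norm_smul, mul_pow, Real.norm_eq_abs,
    sq_abs]
  ring

/-- Second-order upper Taylor bound for `⟨·⟩ ^ k`, uniform in the step size. -/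
lemma exists_jap_rpow_sub_le (d : ℕ) {k : ℝ} (hk : 0 < k) :
    ∃ A : ℝ, 0 ≤ A ∧ ∀ ε : ℝ, 0 < ε → ε ≤ 1 → ∀ x z : Ed d,
      jap (x - ε • z) ^ k - jap x ^ k ≤ -(k * ε * jap x ^ (k - 2)) * inner ℝ x z
        + ε ^ 2 * A * (jap x ^ (k - 2) * ‖z‖ ^ (2 : ℝ) + ‖z‖ ^ k) := by
  rcases le_total k 2 with hk2 | hk2
  · refine ⟨k / 2, by positivity, fun ε _ _ x z => ?_⟩
    have h := rpow_sub_le_of_le_two (zero_lt_one.trans_le (one_le_jap x))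
      (zero_lt_one.trans_le (one_le_jap (x - ε • z))) hk hk2
    rw [jap_sub_smul_sq] at h
    have : 0 ≤ ε ^ 2 * (k / 2) * ‖z‖ ^ k := by positivity
    rw [Real.rpow_two]
    linarith
  · set r := k - 2 with hr
    have hr0 : 0 ≤ r := by linarith
    refine ⟨k / 2 + k * (1 + r) * (1 + 2 ^ r), by positivity, fun ε hε hε1 x z => ?_⟩
    have ha := zero_lt_one.trans_le (one_le_jap x)
    have hb := zero_lt_one.trans_le (one_le_jap (x - ε • z))
    have h1 := rpow_sub_le_of_two_le ha hb hk2
    have h2 := rpow_sub_mul_sq_sub_le ha hb hr0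
    have hsq := jap_sub_smul_sq x z ε
    have habs : |jap (x - ε • z) - jap x| ≤ ε * ‖z‖ := by
      refine (abs_jap_sub_le _ _).trans_eq ?_
      rw [sub_sub_cancel_left, norm_neg, norm_smul, Real.norm_of_nonneg hε.le]
    have hzk : ‖z‖ ^ k = ‖z‖ ^ 2 * ‖z‖ ^ r := by
      rw [← Real.rpow_two, ← Real.rpow_add' (norm_nonneg z) (by linarith)]
      congr 1
      linarith
    rw [hzk, Real.rpow_two]
    rw [← hr] at h1
    generalize jap (x - ε • z) = b at *
    generalize jap x = a at *
    have hsq2 : (b - a) ^ 2 ≤ ε ^ 2 * ‖z‖ ^ 2 := by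
      rw [← mul_pow, ← sq_abs]
      gcongr
    have hbr : b ^ r ≤ 2 ^ r * (a ^ r + ‖z‖ ^ r) := by
      refine le_trans ?_ (add_rpow_le_two_rpow_mul ha.le (norm_nonneg z) hr0)
      have := le_abs_self (b - a)
      have : ε * ‖z‖ ≤ ‖z‖ := mul_le_of_le_one_left (norm_nonneg z) hε1
      gcongr
      linarith
    have hzr : 0 ≤ ‖z‖ ^ r := by positivity
    have har : 0 < a ^ r := by positivity
    have h3 : (a ^ r + b ^ r) * (b - a) ^ 2
        ≤ (1 + 2 ^ r) * (a ^ r + ‖z‖ ^ r) * (ε ^ 2 * ‖z‖ ^ 2) := by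
      gcongr
      linarith
    have h4 := mul_le_mul_of_nonneg_left h3 (by positivity : 0 ≤ k * (1 + r))
    have h5 := mul_le_mul_of_nonneg_left h2 (by positivity : 0 ≤ k / 2)
    have h6 : k / 2 * a ^ r * (b ^ 2 - a ^ 2)
        = k / 2 * a ^ r * (-2 * ε * inner ℝ x z + ε ^ 2 * ‖z‖ ^ 2) := by rw [hsq]
    have h7 : 0 ≤ ε ^ 2 * (k / 2) * (‖z‖ ^ 2 * ‖z‖ ^ r) := by positivity
    linarith

lemma integrable_mul_norm_rpow {E : Type*} [NormedAddCommGroup E] [MeasurableSpace E]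
    [OpensMeasurableSpace E] {μ : Measure E} {J : E → ℝ} (hJnn : ∀ x, 0 ≤ J x)
    (hJmeas : Measurable J) {k' s : ℝ}
    (hJk' : Integrable (fun x => (1 + ‖x‖ ^ k') * J x) μ) (hs : 0 ≤ s) (hsk : s ≤ k') :
    Integrable (fun x => J x * ‖x‖ ^ s) μ := by
  refine hJk'.mono' (hJmeas.mul (measurable_norm.pow_const s)).aestronglyMeasurable
    (ae_of_all _ fun x => ?_)
  have h0 : 0 ≤ J x * ‖x‖ ^ s := mul_nonneg (hJnn x) (by positivity)
  rw [Real.norm_of_nonneg h0, mul_comm]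
  refine mul_le_mul_of_nonneg_right ?_ (hJnn x)
  rcases le_total ‖x‖ 1 with h | h
  · exact (Real.rpow_le_one (norm_nonneg x) h hs).trans (le_add_of_nonneg_right (by positivity))
  · exact (Real.rpow_le_rpow_of_exponent_le h hsk).trans (by linarith)

lemma mul_rpow_sub_two_le {a k B : ℝ} (ha : 1 ≤ a) (hk : 0 < k) (hB : 0 ≤ B) :
    B * a ^ (k - 2) ≤ k / 2 * a ^ k + B * (2 * B / k) ^ k := by
  have ha0 : 0 < a := by linarith
  have e2 : a ^ k = a ^ (k - 2) * a ^ 2 := by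
    rw [← Real.rpow_natCast, ← Real.rpow_add ha0]
    simp
  rcases le_total (2 * B / k) (a ^ 2) with h | h
  · have h1 : B ≤ k / 2 * a ^ 2 := by
      rw [div_le_iff₀ hk] at h
      linarith
    have h2 := mul_le_mul_of_nonneg_right h1 (by positivity : 0 ≤ a ^ (k - 2))
    have : 0 ≤ B * (2 * B / k) ^ k := by positivity
    rw [e2]
    linarith
  · have h1 : a ^ (k - 2) ≤ (2 * B / k) ^ k :=
      (Real.rpow_le_rpow_of_exponent_le ha (by linarith)).trans
        (Real.rpow_le_rpow ha0.le ((le_self_pow₀ ha two_ne_zero).trans h) hk.le)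
    have := mul_le_mul_of_nonneg_left h1 hB
    have : 0 ≤ k / 2 * a ^ k := by positivity
    linarith

/-- Theorem 3.2 (Lyapunov condition in `L¹_k`): if `J` satisfies the moment
normalisation (1) and `J ∈ L¹_{k'}` for some `k' ≥ 2`, then for every `0 < k ≤ k'`
there are constants `C, λ > 0`, independent of `ε ∈ (0,1]`, with
`L_ε^*(⟨·⟩^k)(x) ≤ C - λ ⟨x⟩^k` for all `x`, where
`L_ε^*φ(x) = (1/ε²)(∫ J(z)(φ(x-εz) - φ(x)) dz) - x·∇φ(x)` and
`x·∇(⟨x⟩^k) = k |x|² ⟨x⟩^{k-2}`. -/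
theorem lyapunov_polynomial (d : ℕ) (hd : 1 ≤ d) (k' : ℝ) (hk' : 2 ≤ k')
    (J : Ed d → ℝ) (hJnn : ∀ x, 0 ≤ J x) (hJmeas : Measurable J)
    (hJone : ∫ x, J x = 1) (hJm1 : ∫ x, J x • x = 0)
    (hJm2 : ∀ i j : Fin d, ∫ x, J x * (x i * x j) = if i = j then 2 else 0)
    (hJk' : Integrable (fun x => (1 + ‖x‖ ^ k') * J x)) :
    ∀ k : ℝ, 0 < k → k ≤ k' →
      ∃ C : ℝ, 0 < C ∧ ∃ lam : ℝ, 0 < lam ∧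
        ∀ ε : ℝ, 0 < ε → ε ≤ 1 → ∀ x : Ed d,
          (1 / ε ^ 2) * (∫ z, J z * (jap (x - ε • z) ^ k - jap x ^ k))
              - k * ‖x‖ ^ 2 * jap x ^ (k - 2)
            ≤ C - lam * jap x ^ k := by
  intro k hk hkk'
  obtain ⟨A, hA, hTaylor⟩ := exists_jap_rpow_sub_le d hk
  have hi2 : Integrable (fun z => J z * ‖z‖ ^ (2 : ℝ)) :=
    integrable_mul_norm_rpow hJnn hJmeas hJk' (by norm_num) hk'
  have hik : Integrable (fun z => J z * ‖z‖ ^ k) :=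
    integrable_mul_norm_rpow hJnn hJmeas hJk' hk.le hkk'
  have hi1 : Integrable (fun z => J z • z) := by
    have h := integrable_mul_norm_rpow hJnn hJmeas hJk' zero_le_one (by linarith)
    refine h.mono' (hJmeas.smul measurable_id).aestronglyMeasurable (ae_of_all _ fun z => ?_)
    rw [norm_smul, Real.norm_of_nonneg (hJnn z), Real.rpow_one]
  set M2 := ∫ z, J z * ‖z‖ ^ (2 : ℝ) with hM2
  set Mk := ∫ z, J z * ‖z‖ ^ k with hMk
  have hM2nn : 0 ≤ M2 := integral_nonneg fun z => mul_nonneg (hJnn z) (by positivity)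
  have hMknn : 0 ≤ Mk := integral_nonneg fun z => mul_nonneg (hJnn z) (by positivity)
  have hB : 0 ≤ A * M2 + k := by positivity
  refine ⟨A * Mk + (A * M2 + k) * (2 * (A * M2 + k) / k) ^ k + 1, by positivity, k / 2,
    by positivity, fun ε hε hε1 x => ?_⟩
  have ha := one_le_jap x
  have ha0 : 0 < jap x := by linarith
  have hint : ∫ z, J z * (jap (x - ε • z) ^ k - jap x ^ k)
      ≤ ε ^ 2 * (A * (jap x ^ (k - 2) * M2 + Mk)) := by
    by_cases hI : Integrable (fun z => J z * (jap (x - ε • z) ^ k - jap x ^ k))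
    · have hlin : Integrable (fun z => -(k * ε * jap x ^ (k - 2)) * inner ℝ x (J z • z)) :=
        (hi1.const_inner x).const_mul _
      have hlin0 : ∫ z, -(k * ε * jap x ^ (k - 2)) * inner ℝ x (J z • z) = 0 := by
        rw [integral_const_mul, integral_inner hi1, hJm1, inner_zero_right, mul_zero]
      have hq2 := hi2.const_mul (jap x ^ (k - 2))
      have hquad := (hq2.add hik).const_mul (ε ^ 2 * A)
      refine (integral_mono hI (hlin.add hquad) fun z => ?_).trans_eq ?_
      · have := mul_le_mul_of_nonneg_left (hTaylor ε hε hε1 x z) (hJnn z)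
        simp only [Pi.add_apply, inner_smul_right]
        linarith
      · rw [integral_add' hlin hquad, hlin0, integral_const_mul, integral_add' hq2 hik,
          integral_const_mul]
        ring
    · rw [integral_undef hI]
      positivity
  have hdiv : (1 / ε ^ 2) * (∫ z, J z * (jap (x - ε • z) ^ k - jap x ^ k))
      ≤ A * (jap x ^ (k - 2) * M2 + Mk) := by
    rw [one_div, inv_mul_le_iff₀ (by positivity)]
    exact hint
  have hdrift : k * ‖x‖ ^ 2 * jap x ^ (k - 2) = k * jap x ^ k - k * jap x ^ (k - 2) := by
    have hx : ‖x‖ ^ 2 = jap x ^ 2 - 1 := by linarith [jap_sq x]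
    have hpow : jap x ^ k = jap x ^ (k - 2) * jap x ^ 2 := by
      rw [← Real.rpow_natCast, ← Real.rpow_add ha0]
      simp
    rw [hx, hpow]
    ring
  have hlow := mul_rpow_sub_two_le ha hk hB
  rw [hdrift]
  linarith
end
end

section
/- Define s_m := e^{−m} Σ_{n=m}^{2m} m^n / n! for integers m ≥ 1. Then there exists a constant C_L > 0 such that s_m ≥ C_L for all m ≥ 1, and moreover lim_{m → ∞} s_m = 1/2. -/
open Filter

/-- The probability that a Poisson variable of parameter `r` takes the value `n`. -/
noncomputable def poissonWeight (r : ℝ) (n : ℕ) : ℝ :=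
  Real.exp (-r) * (r ^ n / n.factorial)

lemma poissonWeight_nonneg {r : ℝ} (hr : 0 ≤ r) (n : ℕ) : 0 ≤ poissonWeight r n := by
  unfold poissonWeight
  positivity

lemma succ_mul_poissonWeight_succ (r : ℝ) (n : ℕ) :
    ((n : ℝ) + 1) * poissonWeight r (n + 1) = r * poissonWeight r n := by
  unfold poissonWeight
  rw [Nat.factorial_succ]
  push_cast
  field_simp
  ring

lemma hasSum_poissonWeight (r : ℝ) : HasSum (poissonWeight r) 1 := by
  have h := (NormedSpace.expSeries_div_hasSum_exp r).mul_left (Real.exp (-r))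
  rwa [← Real.exp_eq_exp_ℝ, ← Real.exp_add, neg_add_cancel, Real.exp_zero] at h

lemma hasSum_mul_poissonWeight (r : ℝ) : HasSum (fun n : ℕ => (n : ℝ) * poissonWeight r n) r := by
  rw [← hasSum_nat_add_iff' 1]
  simpa [succ_mul_poissonWeight_succ] using (hasSum_poissonWeight r).mul_left r

lemma hasSum_sq_mul_poissonWeight (r : ℝ) :
    HasSum (fun n : ℕ => (n : ℝ) ^ 2 * poissonWeight r n) (r * (r + 1)) := by
  rw [← hasSum_nat_add_iff' 1]
  have h := ((hasSum_mul_poissonWeight r).add (hasSum_poissonWeight r)).mul_left r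
  convert! h using 1
  · ext n
    push_cast
    linear_combination ((n : ℝ) + 1) * succ_mul_poissonWeight_succ r n
  · simp

/-- The variance of a Poisson variable of parameter `r` is `r`. -/
lemma hasSum_sub_sq_mul_poissonWeight (r : ℝ) :
    HasSum (fun n : ℕ => ((n : ℝ) - r) ^ 2 * poissonWeight r n) r := by
  have h := ((hasSum_sq_mul_poissonWeight r).sub ((hasSum_mul_poissonWeight r).mul_left (2 * r))).add
    ((hasSum_poissonWeight r).mul_left (r ^ 2))
  convert! h using 1
  · ext n
    ring
  · ring

lemma sum_range_sq_mul_poissonWeight_add_le (m K : ℕ) :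
    ∑ k ∈ Finset.range K, (k : ℝ) ^ 2 * poissonWeight m (m + k) ≤ m := by
  have h := hasSum_sub_sq_mul_poissonWeight (m : ℝ)
  have hnn : ∀ n : ℕ, 0 ≤ ((n : ℝ) - m) ^ 2 * poissonWeight m n := fun n =>
    mul_nonneg (sq_nonneg _) (poissonWeight_nonneg m.cast_nonneg n)
  have hle := sum_le_hasSum (Finset.range (m + K)) (fun n _ => hnn n) h
  rw [Finset.sum_range_add] at hle
  have h0 : 0 ≤ ∑ n ∈ Finset.range m, ((n : ℝ) - m) ^ 2 * poissonWeight m n :=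
    Finset.sum_nonneg fun n _ => hnn n
  simp only [Nat.cast_add, add_sub_cancel_left] at hle
  linarith

/-- Chebyshev's inequality for the upper tail at twice the mean. -/
lemma one_sub_inv_le_sum_range_poissonWeight {m : ℕ} (hm : 1 ≤ m) :
    1 - (m : ℝ)⁻¹ ≤ ∑ n ∈ Finset.range (2 * m), poissonWeight m n := by
  have hm' : (0 : ℝ) < m := by exact_mod_cast hm
  have h := ((hasSum_sub_sq_mul_poissonWeight (m : ℝ)).mul_left (((m : ℝ) ^ 2)⁻¹))
  have h1 := (hasSum_poissonWeight (m : ℝ)).sub h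
  have hle := sum_le_hasSum (f := fun n => -(poissonWeight (m : ℝ) n
      - ((m : ℝ) ^ 2)⁻¹ * (((n : ℝ) - m) ^ 2 * poissonWeight m n)))
    (Finset.range (2 * m)) (fun n hn => ?_) h1.neg
  · have hmono : ∑ n ∈ Finset.range (2 * m), -(poissonWeight (m : ℝ) n) ≤
        ∑ n ∈ Finset.range (2 * m), -(poissonWeight (m : ℝ) n
          - ((m : ℝ) ^ 2)⁻¹ * (((n : ℝ) - m) ^ 2 * poissonWeight m n)) := by
      refine Finset.sum_le_sum fun n _ => ?_
      have := poissonWeight_nonneg hm'.le n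
      have : 0 ≤ ((m : ℝ) ^ 2)⁻¹ * (((n : ℝ) - m) ^ 2 * poissonWeight m n) := by positivity
      linarith
    rw [Finset.sum_neg_distrib] at hmono
    have : ((m : ℝ) ^ 2)⁻¹ * m = (m : ℝ)⁻¹ := by field_simp
    linarith
  · have hn' : (2 : ℝ) * m ≤ n := by
      simp only [Finset.mem_range, not_lt] at hn
      exact_mod_cast hn
    have hw := poissonWeight_nonneg hm'.le n
    have hsq : 1 ≤ ((m : ℝ) ^ 2)⁻¹ * ((n : ℝ) - m) ^ 2 := by
      rw [inv_mul_eq_div, one_le_div (by positivity)]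
      exact pow_le_pow_left₀ hm'.le (by linarith) 2
    nlinarith [mul_le_mul_of_nonneg_right hsq hw]

/-- The weights reflected about the mean differ by a relative error of at most `k ^ 3 / m ^ 2`. -/
lemma poissonWeight_reflect_bounds {m : ℕ} (k : ℕ) (hk : k < m) :
    poissonWeight m (m - 1 - k) ≤ poissonWeight m (m + k) ∧
      poissonWeight m (m + k) * (1 - (k : ℝ) ^ 3 / (m : ℝ) ^ 2) ≤
        poissonWeight m (m - 1 - k) := by
  have hm : (0 : ℝ) < m := by exact_mod_cast (by omega : 0 < m)
  induction k with
  | zero =>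
    obtain ⟨d, rfl⟩ : ∃ d, m = d + 1 := ⟨m - 1, by omega⟩
    have h := succ_mul_poissonWeight_succ ((d + 1 : ℕ) : ℝ) d
    have h' : poissonWeight ((d + 1 : ℕ) : ℝ) (d + 1) = poissonWeight ((d + 1 : ℕ) : ℝ) d := by
      apply mul_left_cancel₀ hm.ne'
      rw [← h]
      push_cast
      ring
    rw [add_zero, tsub_zero, add_tsub_cancel_right, h']
    simp
  | succ k ih =>
    obtain ⟨ih₁, ih₂⟩ := ih (by omega)
    have hkm : ((k : ℝ) + 1) < m := by exact_mod_cast hk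
    have hk0 : (0 : ℝ) ≤ k := k.cast_nonneg
    have hup := succ_mul_poissonWeight_succ (m : ℝ) (m + k)
    have hdown := succ_mul_poissonWeight_succ (m : ℝ) (m - 1 - (k + 1))
    have hidx : m - 1 - (k + 1) + 1 = m - 1 - k := by omega
    have hcast : ((m - 1 - (k + 1) : ℕ) : ℝ) + 1 = m - (k + 1) := by
      rw [eq_sub_iff_add_eq]
      exact_mod_cast (by omega : m - 1 - (k + 1) + 1 + (k + 1) = m)
    rw [hidx, hcast] at hdown
    rw [← Nat.add_assoc]
    have ha := poissonWeight_nonneg hm.le (m + k + 1)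
    push_cast at hup ⊢
    set a := poissonWeight (m : ℝ) (m + k)
    set a' := poissonWeight (m : ℝ) (m + k + 1)
    set b := poissonWeight (m : ℝ) (m - 1 - k)
    set b' := poissonWeight (m : ℝ) (m - 1 - (k + 1))
    have ea : a = (m + k + 1) * a' / m := by field_simp; linarith
    have eb : b' = (m - (k + 1)) * b / m := by field_simp; linarith
    have hd : (0 : ℝ) ≤ (m - (k + 1)) / m := div_nonneg (by linarith) hm.le
    have key : (m - (k + 1)) / m * a = a' * (1 - ((k : ℝ) + 1) ^ 2 / m ^ 2) := by
      rw [ea]; field_simp; ring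
    have eb' : b' = (m - (k + 1)) / m * b := by rw [eb]; ring
    constructor
    · calc b' ≤ (m - (k + 1)) / m * a := by rw [eb']; gcongr
        _ = a' * (1 - ((k : ℝ) + 1) ^ 2 / m ^ 2) := key
        _ ≤ a' * 1 := by
            gcongr
            have : (0 : ℝ) ≤ ((k : ℝ) + 1) ^ 2 / m ^ 2 := by positivity
            linarith
        _ = a' := mul_one _
    · calc a' * (1 - ((k : ℝ) + 1) ^ 3 / m ^ 2)
          ≤ a' * ((1 - ((k : ℝ) + 1) ^ 2 / m ^ 2) * (1 - (k : ℝ) ^ 3 / m ^ 2)) := by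
            gcongr
            have h1 : (0 : ℝ) ≤ ((k : ℝ) + 1) ^ 2 / m ^ 2 * ((k : ℝ) ^ 3 / m ^ 2) := by positivity
            have h2 : (0 : ℝ) ≤ (((k : ℝ) + 1) ^ 3 - (k + 1) ^ 2 - k ^ 3) / m ^ 2 := by
              apply div_nonneg _ (by positivity)
              nlinarith [sq_nonneg (k : ℝ)]
            rw [sub_div, sub_div] at h2
            linarith
        _ = (m - (k + 1)) / m * (a * (1 - (k : ℝ) ^ 3 / m ^ 2)) := by
            rw [← mul_assoc, ← mul_assoc, key]
        _ ≤ b' := by rw [eb']; gcongr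

lemma sum_range_poissonWeight_add_bounds {m : ℕ} (hm : 1 ≤ m) :
    ∑ n ∈ Finset.range m, poissonWeight m n ≤
        ∑ k ∈ Finset.range m, poissonWeight m (m + k) ∧
      ∑ k ∈ Finset.range m, poissonWeight m (m + k) ≤
        ∑ n ∈ Finset.range m, poissonWeight m n + (m : ℝ) ^ (-(1 / 3) : ℝ) := by
  have hm' : (0 : ℝ) < m := by exact_mod_cast hm
  rw [← Finset.sum_range_reflect (fun n => poissonWeight (m : ℝ) n)]
  refine ⟨Finset.sum_le_sum fun k hk =>
    (poissonWeight_reflect_bounds k (Finset.mem_range.1 hk)).1, ?_⟩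
  rw [← sub_le_iff_le_add', ← Finset.sum_sub_distrib]
  set t : ℝ := (m : ℝ) ^ (1 / 3 : ℝ) with ht_def
  have ht : 0 < t := by positivity
  have ht3 : t ^ 3 = m := by
    rw [ht_def, ← Real.rpow_natCast, ← Real.rpow_mul hm'.le]
    norm_num
  calc ∑ k ∈ Finset.range m, (poissonWeight m (m + k) - poissonWeight m (m - 1 - k))
      ≤ ∑ k ∈ Finset.range m, (t ^ 4)⁻¹ * ((k : ℝ) ^ 2 * poissonWeight m (m + k)) := by
        refine Finset.sum_le_sum fun k hk => ?_
        have ha := poissonWeight_nonneg hm'.le (m + k)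
        have hb := poissonWeight_nonneg hm'.le (m - 1 - k)
        have hr := (poissonWeight_reflect_bounds k (Finset.mem_range.1 hk)).2
        rcases le_total (k : ℝ) (t ^ 2) with hkt | hkt
        · have : (k : ℝ) ^ 3 / (m : ℝ) ^ 2 ≤ (t ^ 4)⁻¹ * (k : ℝ) ^ 2 := by
            rw [← ht3]
            calc (k : ℝ) ^ 3 / (t ^ 3) ^ 2 = (t ^ 6)⁻¹ * (k : ℝ) ^ 2 * k := by ring
              _ ≤ (t ^ 6)⁻¹ * (k : ℝ) ^ 2 * t ^ 2 := by gcongr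
              _ = (t ^ 4)⁻¹ * (k : ℝ) ^ 2 := by field_simp
          nlinarith [mul_le_mul_of_nonneg_right this ha]
        · have : 1 ≤ (t ^ 4)⁻¹ * (k : ℝ) ^ 2 := by
            rw [inv_mul_eq_div, one_le_div (by positivity)]
            calc t ^ 4 = (t ^ 2) ^ 2 := by ring
              _ ≤ (k : ℝ) ^ 2 := by gcongr
          nlinarith [mul_le_mul_of_nonneg_right this ha]
    _ ≤ (t ^ 4)⁻¹ * m := by
        rw [← Finset.mul_sum]
        gcongr
        exact sum_range_sq_mul_poissonWeight_add_le m m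
    _ = (m : ℝ) ^ (-(1 / 3) : ℝ) := by
        rw [Real.rpow_neg hm'.le, ← ht_def, ← ht3]
        field_simp

lemma sum_Icc_poissonWeight_bounds {m : ℕ} (hm : 1 ≤ m) :
    1 / 2 - (m : ℝ)⁻¹ ≤ ∑ n ∈ Finset.Icc m (2 * m), poissonWeight m n ∧
      ∑ n ∈ Finset.Icc m (2 * m), poissonWeight m n ≤
        1 / 2 + (m : ℝ)⁻¹ + (m : ℝ) ^ (-(1 / 3) : ℝ) := by
  have hm' : (0 : ℝ) < m := by exact_mod_cast hm
  obtain ⟨hlow, hupp⟩ := sum_range_poissonWeight_add_bounds hm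
  have htail := one_sub_inv_le_sum_range_poissonWeight hm
  have htot := sum_le_hasSum (Finset.range (2 * m + 1))
    (fun n _ => poissonWeight_nonneg hm'.le n) (hasSum_poissonWeight (m : ℝ))
  have hlast := poissonWeight_nonneg hm'.le (2 * m)
  have hsum : ∑ n ∈ Finset.Icc m (2 * m), poissonWeight m n =
      ∑ k ∈ Finset.range m, poissonWeight m (m + k) + poissonWeight m (2 * m) := by
    rw [← Finset.Ico_add_one_right_eq_Icc, Finset.sum_Ico_succ_top (by omega),
      Finset.sum_Ico_eq_sum_range]
    congr 3
    omega
  have hinv : 0 < (m : ℝ)⁻¹ := by positivity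
  have hpow : 0 ≤ (m : ℝ) ^ (-(1 / 3) : ℝ) := by positivity
  rw [Finset.sum_range_succ] at htot
  have hsplit : ∑ n ∈ Finset.range (2 * m), poissonWeight m n =
      ∑ n ∈ Finset.range m, poissonWeight m n +
        ∑ k ∈ Finset.range m, poissonWeight m (m + k) := by
    rw [two_mul, Finset.sum_range_add]
  rw [hsum]
  constructor <;> linarith

lemma tendsto_sum_Icc_poissonWeight :
    Tendsto (fun m : ℕ => ∑ n ∈ Finset.Icc m (2 * m), poissonWeight m n) atTop
      (nhds (1 / 2)) := by
  have hinv : Tendsto (fun m : ℕ => (m : ℝ)⁻¹) atTop (nhds 0) := tendsto_inv_atTop_nhds_zero_nat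
  have hpow : Tendsto (fun m : ℕ => (m : ℝ) ^ (-(1 / 3) : ℝ)) atTop (nhds 0) :=
    (tendsto_rpow_neg_atTop (by norm_num)).comp tendsto_natCast_atTop_atTop
  have hlow : Tendsto (fun m : ℕ => 1 / 2 - (m : ℝ)⁻¹) atTop (nhds (1 / 2)) := by
    simpa only [sub_zero] using hinv.const_sub (1 / 2)
  have hupp : Tendsto (fun m : ℕ => 1 / 2 + (m : ℝ)⁻¹ + (m : ℝ) ^ (-(1 / 3) : ℝ)) atTop
      (nhds (1 / 2)) := by
    simpa only [add_zero] using (hinv.const_add (1 / 2)).add hpow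
  refine tendsto_of_tendsto_of_tendsto_of_le_of_le' hlow hupp ?_ ?_
  · filter_upwards [eventually_ge_atTop 1] with m hm using (sum_Icc_poissonWeight_bounds hm).1
  · filter_upwards [eventually_ge_atTop 1] with m hm using (sum_Icc_poissonWeight_bounds hm).2

/-- A sequence of positive reals with a positive limit is bounded below by a positive constant. -/
lemma exists_pos_forall_le_of_tendsto {f : ℕ → ℝ} {l : ℝ} (hl : 0 < l) (hf : ∀ n, 0 < f n)
    (h : Tendsto f atTop (nhds l)) : ∃ C : ℝ, 0 < C ∧ ∀ n, C ≤ f n := by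
  obtain ⟨B, hB⟩ := (h.inv₀ hl.ne').bddAbove_range
  have hB' : ∀ n, (f n)⁻¹ ≤ B := fun n => hB ⟨n, rfl⟩
  have hpos : 0 < B := (inv_pos.2 (hf 0)).trans_le (hB' 0)
  exact ⟨B⁻¹, inv_pos.2 hpos, fun n => inv_le_of_inv_le₀ (hf n) (hB' n)⟩

/-- Lemma 3.13: the partial sums `s_m := e^{-m} Σ_{n=m}^{2m} m^n/n!` (the probability
that a Poisson variable of parameter `m` lies in `[m, 2m]`) are bounded below by a
positive constant for `m ≥ 1`, and converge to `1/2` as `m → ∞`. -/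
theorem poisson_partial_sum_lower_bound :
    (∃ C : ℝ, 0 < C ∧ ∀ m : ℕ, 1 ≤ m →
      C ≤ Real.exp (-(m : ℝ)) * ∑ n ∈ Finset.Icc m (2 * m), (m : ℝ) ^ n / n.factorial) ∧
    Tendsto (fun m : ℕ =>
        Real.exp (-(m : ℝ)) * ∑ n ∈ Finset.Icc m (2 * m), (m : ℝ) ^ n / n.factorial)
      atTop (nhds (1 / 2)) := by
  have heq : ∀ m : ℕ, Real.exp (-(m : ℝ)) * ∑ n ∈ Finset.Icc m (2 * m),
      (m : ℝ) ^ n / n.factorial = ∑ n ∈ Finset.Icc m (2 * m), poissonWeight m n := fun m =>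
    Finset.mul_sum _ _ _
  simp only [heq]
  refine ⟨?_, tendsto_sum_Icc_poissonWeight⟩
  have hpos : ∀ m : ℕ, 0 < ∑ n ∈ Finset.Icc m (2 * m), poissonWeight m n := fun m => by
    refine Finset.sum_pos' (fun n _ => poissonWeight_nonneg m.cast_nonneg n)
      ⟨m, Finset.mem_Icc.2 ⟨le_rfl, by omega⟩, ?_⟩
    rcases Nat.eq_zero_or_pos m with rfl | hm
    · simp [poissonWeight]
    · unfold poissonWeight
      positivity
  obtain ⟨C, hC, hle⟩ :=
    exists_pos_forall_le_of_tendsto one_half_pos hpos tendsto_sum_Icc_poissonWeight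
  exact ⟨C, hC, fun m _ => hle m⟩
end
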